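/- Under the standing hypotheses, no three of the four numbers a + 6d, a + 5d, a + 4d, a + 3d can be written in the 2-dominated form with top exponent n: there do not exist nonnegative integers p > q > r such that 2^n + 3^p, 2^n + 3^q, and 2^n + 3^r are three distinct elements of {a + 6d, a + 5d, a + 4d, a + 3d}. -/

import Mathlib

/-- Under the standing hypotheses, no three of a + 6d, a + 5d, a + 4d, a + 3d are 2-dominated (of the form 3^x + 2^n). -/
theorem no_three_2_dominated (a d m n : ℕ)
    (ha : 0 < a) (hd : 0 < d)
    (hAP : ∀ i : ℕ, i ≤ 6 → ∃ x y : ℕ, a + i * d = 3 ^ x + 2 ^ y)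
    (hbig : 3 ^ 9 ≤ a + 6 * d)
    (hm₁ : 3 ^ m ≤ a + 6 * d) (hm₂ : a + 6 * d < 3 ^ (m + 1))
    (hn₁ : 2 ^ n ≤ a + 6 * d) (hn₂ : a + 6 * d < 2 ^ (n + 1)) :
    ¬ ∃ p q r : ℕ, r < q ∧ q < p ∧
      2 ^ n + 3 ^ p ∈ ({a + 6 * d, a + 5 * d, a + 4 * d, a + 3 * d} : Set ℕ) ∧
      2 ^ n + 3 ^ q ∈ ({a + 6 * d, a + 5 * d, a + 4 * d, a + 3 * d} : Set ℕ) ∧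
      2 ^ n + 3 ^ r ∈ ({a + 6 * d, a + 5 * d, a + 4 * d, a + 3 * d} : Set ℕ) := by
  rintro ⟨p, q, r, hrq, hqp, hp, hq, hr⟩
  have h₁ : 3 * 3 ^ q ≤ 3 ^ p := by
    rw [← pow_succ']
    exact Nat.pow_le_pow_right (by norm_num) hqp
  have h₂ : 3 ^ r < 3 ^ q := Nat.pow_lt_pow_right (by norm_num) hrq
  have h₃ : 0 < 3 ^ r := by positivity
  simp only [Set.mem_insert_iff, Set.mem_singleton_iff] at hp hq hr
  clear hAP hbig hm₁ hm₂ hn₁ hn₂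
  generalize 3 ^ p = P at *
  generalize 3 ^ q = Q at *
  generalize 3 ^ r = R at *
  generalize 2 ^ n = N at *
  omega
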